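/- Let ℓ₁, ℓ₂ > 0, let J₁ ⊆ (0,ℓ₁) and J₂ ⊆ (0,ℓ₂) be measurable sets, and set S̄ = (J₁×(0,ℓ₂)) ∪ ((0,ℓ₁)×J₂) ⊂ Ω = (0,ℓ₁)×(0,ℓ₂). Define t₁ = inf_{k≥1} ∫_{J₁} sin²(πkx/ℓ₁) dx, t₂ = inf_{k≥1} ∫_{J₂} sin²(πkx/ℓ₂) dx and m = min{t₁/ℓ₁, t₂/ℓ₂}. Suppose T > 0 satisfies (ℓ₁²+ℓ₂²)(ℓ₁⁴+ℓ₂⁴)/(T²ℓ₁²ℓ₂²) < m. For k = (k₁,k₂) with integers k₁,k₂ ≥ 1, let γ_k = π²(k₁²/ℓ₁² + k₂²/ℓ₂²), ω_k = √γ_k, and φ_k(x₁,x₂) = (2/√(ℓ₁ℓ₂)) sin(πk₁x₁/ℓ₁) sin(πk₂x₂/ℓ₂). Then for every finitely supported family of real numbers (c_k, d_k), the function u(t,x) = Σ_k (c_k cos(ω_k t) + (d_k/ω_k) sin(ω_k t)) φ_k(x) satisfies c·(Σ_k c_k² + Σ_k d_k²/γ_k) ≤ ∫₀^T ∫_{S̄}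 u(t,x)² dx dt, where c = (T/π)·(m − (ℓ₁²+ℓ₂²)(ℓ₁⁴+ℓ₂⁴)/(T²ℓ₁²ℓ₂²)) > 0. -/

import Mathlib

open Real Set MeasureTheory

noncomputable section

/-- The eigenvalues `γ_k = π²(k₁²/ℓ₁² + k₂²/ℓ₂²)` of `−Δ` on `(0,ℓ₁) × (0,ℓ₂)`. -/
def gam (ℓ₁ ℓ₂ : ℝ) (k : ℕ × ℕ) : ℝ :=
  π ^ 2 * ((k.1 : ℝ) ^ 2 / ℓ₁ ^ 2 + (k.2 : ℝ) ^ 2 / ℓ₂ ^ 2)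

/-- `ω_k = √γ_k`. -/
def om (ℓ₁ ℓ₂ : ℝ) (k : ℕ × ℕ) : ℝ := Real.sqrt (gam ℓ₁ ℓ₂ k)

/-- The normalized eigenfunctions `φ_k` on the rectangle `(0,ℓ₁) × (0,ℓ₂)`. -/
def phiR (ℓ₁ ℓ₂ : ℝ) (k : ℕ × ℕ) (p : ℝ × ℝ) : ℝ :=
  (2 / Real.sqrt (ℓ₁ * ℓ₂)) * Real.sin (π * k.1 * p.1 / ℓ₁) * Real.sin (π * k.2 * p.2 / ℓ₂)

/-- The solution of the wave equation on the rectangle with initial data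
`(Σ c_k φ_k, Σ d_k φ_k)`. -/
def usol (ℓ₁ ℓ₂ : ℝ) (F : Finset (ℕ × ℕ)) (c d : ℕ × ℕ → ℝ) (t : ℝ) (p : ℝ × ℝ) : ℝ :=
  ∑ k ∈ F, (c k * Real.cos (om ℓ₁ ℓ₂ k * t) +
    d k / om ℓ₁ ℓ₂ k * Real.sin (om ℓ₁ ℓ₂ k * t)) * phiR ℓ₁ ℓ₂ k p


/-- The normalized Dirichlet eigenfunctions of the interval `(0,ℓ)`. -/
def sineMode (ℓ : ℝ) (k : ℕ) (x : ℝ) : ℝ := √(2 / ℓ) * sin (π * k * x / ℓ)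

/-- Gram matrix of the Dirichlet eigenfunctions of `(0,ℓ)` on a subset `J`. -/
def sineGram (ℓ : ℝ) (J : Set ℝ) (j k : ℕ) : ℝ := ∫ x in J, sineMode ℓ j x * sineMode ℓ k x

@[fun_prop]
lemma continuous_sineMode (ℓ : ℝ) (k : ℕ) : Continuous (sineMode ℓ k) := by
  unfold sineMode; fun_prop

lemma sineGram_comm (ℓ : ℝ) (J : Set ℝ) (j k : ℕ) : sineGram ℓ J j k = sineGram ℓ J k j := by
  simp only [sineGram, mul_comm]

lemma Continuous.integrableOn_of_subset_Ioo {f : ℝ → ℝ} (hf : Continuous f) {J : Set ℝ} {ℓ : ℝ}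
    (hJ : J ⊆ Ioo 0 ℓ) : IntegrableOn f J :=
  (hf.continuousOn.integrableOn_Icc (a := 0) (b := ℓ)).mono_set (hJ.trans Ioo_subset_Icc_self)

lemma integral_cos_int_mul_pi_div {ℓ : ℝ} (hℓ : 0 < ℓ) {n : ℤ} (hn : n ≠ 0) :
    ∫ x in (0 : ℝ)..ℓ, cos (π * n / ℓ * x) = 0 := by
  have hc : π * n / ℓ ≠ 0 := by
    have : (n : ℝ) ≠ 0 := by exact_mod_cast hn
    positivity
  rw [intervalIntegral.integral_comp_mul_left (fun x => cos x) hc, integral_cos]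
  have : π * n / ℓ * ℓ = n * π := by field_simp
  rw [this, sin_int_mul_pi]
  simp

lemma sineGram_Ioo {ℓ : ℝ} (hℓ : 0 < ℓ) {j k : ℕ} (hj : 1 ≤ j) (hk : 1 ≤ k) :
    sineGram ℓ (Ioo 0 ℓ) j k = if j = k then 1 else 0 := by
  have key : ∀ x, sineMode ℓ j x * sineMode ℓ k x =
      1 / ℓ * (cos (π * ((j - k : ℤ) : ℝ) / ℓ * x) - cos (π * ((j + k : ℤ) : ℝ) / ℓ * x)) := by
    intro x
    have h1 : π * ((j - k : ℤ) : ℝ) / ℓ * x = π * j * x / ℓ - π * k * x / ℓ := by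
      push_cast; ring
    have h2 : π * ((j + k : ℤ) : ℝ) / ℓ * x = π * j * x / ℓ + π * k * x / ℓ := by
      push_cast; ring
    have h3 : √(2 / ℓ) * √(2 / ℓ) = 2 / ℓ := mul_self_sqrt (by positivity)
    rw [h1, h2, cos_sub, cos_add]
    unfold sineMode
    linear_combination (sin (π * j * x / ℓ) * sin (π * k * x / ℓ)) * h3
  rw [sineGram, ← integral_Ioc_eq_integral_Ioo, ← intervalIntegral.integral_of_le hℓ.le]
  simp only [key]
  rw [intervalIntegral.integral_const_mul, intervalIntegral.integral_sub
    (Continuous.intervalIntegrable (by fun_prop) _ _)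
    (Continuous.intervalIntegrable (by fun_prop) _ _),
    integral_cos_int_mul_pi_div hℓ (n := j + k) (by omega)]
  split_ifs with h
  · subst h
    simp [hℓ.ne']
  · rw [integral_cos_int_mul_pi_div hℓ (by omega)]
    simp

lemma integral_sq_sum {α ι : Type*} [MeasurableSpace α] {μ : Measure α} (I : Finset ι)
    (a : ι → ℝ) (f : ι → α → ℝ) (hf : ∀ i ∈ I, ∀ j ∈ I, Integrable (fun x => f i x * f j x) μ) :
    ∫ x, (∑ i ∈ I, a i * f i x) ^ 2 ∂μ =
      ∑ i ∈ I, ∑ j ∈ I, a i * a j * ∫ x, f i x * f j x ∂μ := by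
  have : ∀ x, (∑ i ∈ I, a i * f i x) ^ 2 =
      ∑ i ∈ I, ∑ j ∈ I, a i * a j * (f i x * f j x) := by
    intro x
    rw [sq, Finset.sum_mul_sum]
    exact Finset.sum_congr rfl fun i _ => Finset.sum_congr rfl fun j _ => by ring
  simp only [this]
  rw [integral_finsetSum _ fun i hi => integrable_finsetSum _ fun j hj =>
    (hf i hi j hj).const_mul _]
  refine Finset.sum_congr rfl fun i hi => ?_
  rw [integral_finsetSum _ fun j hj => (hf i hi j hj).const_mul _]
  exact Finset.sum_congr rfl fun j _ => integral_const_mul _ _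

lemma integral_sq_sum_sineMode {ℓ : ℝ} {J : Set ℝ} (hJ : J ⊆ Ioo 0 ℓ) (I : Finset ℕ)
    (a : ℕ → ℝ) : ∫ x in J, (∑ i ∈ I, a i * sineMode ℓ i x) ^ 2 =
      ∑ i ∈ I, ∑ j ∈ I, a i * a j * sineGram ℓ J i j :=
  integral_sq_sum I a _ fun i _ j _ =>
    Continuous.integrableOn_of_subset_Ioo (by fun_prop) hJ

lemma sum_sineGram_sq_le {ℓ : ℝ} (hℓ : 0 < ℓ) {J : Set ℝ}
    (hJ : J ⊆ Ioo 0 ℓ) {I : Finset ℕ} (hI : ∀ i ∈ I, 1 ≤ i) (k : ℕ) :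
    ∑ j ∈ I, sineGram ℓ J k j ^ 2 ≤ sineGram ℓ J k k := by
  set g : ℝ → ℝ := fun x => ∑ j ∈ I, sineGram ℓ J k j * sineMode ℓ j x with hg
  have hgc : Continuous g := by rw [hg]; fun_prop
  have h1 : ∫ x in Ioo 0 ℓ, g x ^ 2 = ∑ j ∈ I, sineGram ℓ J k j ^ 2 := by
    rw [hg, integral_sq_sum_sineMode subset_rfl]
    refine Finset.sum_congr rfl fun i hi => ?_
    rw [Finset.sum_eq_single_of_mem i hi]
    · rw [sineGram_Ioo hℓ (hI i hi) (hI i hi)]; simp [sq]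
    · intro j hj hji
      rw [sineGram_Ioo hℓ (hI i hi) (hI j hj), if_neg (Ne.symm hji)]; simp
  have h2 : ∫ x in J, g x ^ 2 ≤ ∫ x in Ioo 0 ℓ, g x ^ 2 :=
    setIntegral_mono_set (Continuous.integrableOn_of_subset_Ioo (by fun_prop) subset_rfl)
      (Filter.Eventually.of_forall fun x => sq_nonneg (g x)) hJ.eventuallyLE
  have h3 : ∫ x in J, sineMode ℓ k x * g x = ∑ j ∈ I, sineGram ℓ J k j ^ 2 := by
    simp only [hg, Finset.mul_sum]
    rw [integral_finsetSum _ fun j _ =>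
      Continuous.integrableOn_of_subset_Ioo (by fun_prop) hJ]
    refine Finset.sum_congr rfl fun j _ => ?_
    rw [sq]
    nth_rewrite 3 [sineGram]
    rw [← integral_const_mul]
    congr 1; ext x; ring
  have h4 : 0 ≤ ∫ x in J, (sineMode ℓ k x - g x) ^ 2 := integral_nonneg fun x => sq_nonneg _
  have h5 : ∫ x in J, (sineMode ℓ k x - g x) ^ 2 =
      sineGram ℓ J k k - 2 * (∫ x in J, sineMode ℓ k x * g x) + ∫ x in J, g x ^ 2 := by
    rw [sineGram, ← integral_const_mul, ← integral_sub, ← integral_add]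
    · congr 1; ext x; ring
    all_goals first
      | exact Continuous.integrableOn_of_subset_Ioo (by fun_prop) hJ
  linarith

lemma sum_erase_sineGram_sq_le {ℓ : ℝ} (hℓ : 0 < ℓ) {J : Set ℝ}
    (hJ : J ⊆ Ioo 0 ℓ) {I : Finset ℕ} (hI : ∀ i ∈ I, 1 ≤ i) {k : ℕ} (hk : k ∈ I) :
    ∑ j ∈ I.erase k, sineGram ℓ J k j ^ 2 ≤ 1 / 4 := by
  have h := sum_sineGram_sq_le hℓ hJ hI k
  rw [← Finset.add_sum_erase I _ hk] at h
  nlinarith [sq_nonneg (sineGram ℓ J k k - 1 / 2)]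

lemma sineGram_self_nonneg (ℓ : ℝ) (J : Set ℝ) (k : ℕ) : 0 ≤ sineGram ℓ J k k :=
  integral_nonneg fun _ => mul_self_nonneg _

lemma sineGram_self_le_one {ℓ : ℝ} (hℓ : 0 < ℓ) {J : Set ℝ}
    (hJ : J ⊆ Ioo 0 ℓ) {k : ℕ} (hk : 1 ≤ k) : sineGram ℓ J k k ≤ 1 := by
  have h := sum_sineGram_sq_le hℓ hJ (I := {k}) (by simpa using hk) k
  simp only [Finset.sum_singleton] at h
  nlinarith

lemma integral_sin_sq_eq {ℓ : ℝ} (hℓ : 0 < ℓ) (J : Set ℝ) (k : ℕ) :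
    ∫ x in J, sin (π * k * x / ℓ) ^ 2 = ℓ / 2 * sineGram ℓ J k k := by
  rw [sineGram, ← integral_const_mul]
  congr 1; ext x
  have h3 : √(2 / ℓ) * √(2 / ℓ) = 2 / ℓ := mul_self_sqrt (by positivity)
  have : ℓ / 2 * (2 / ℓ) = 1 := by field_simp
  unfold sineMode
  linear_combination -(ℓ / 2 * sin (π * k * x / ℓ) ^ 2) * h3 - sin (π * k * x / ℓ) ^ 2 * this

lemma exists_amplitude_phase (A B : ℝ) : ∃ r φ : ℝ, r ^ 2 = A ^ 2 + B ^ 2 ∧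
    ∀ θ, A * cos θ + B * sin θ = r * cos (θ - φ) := by
  refine ⟨‖(⟨A, B⟩ : ℂ)‖, Complex.arg ⟨A, B⟩, ?_, fun θ => ?_⟩
  · rw [Complex.sq_norm, Complex.normSq_mk]; ring
  · have h1 := Complex.norm_mul_cos_arg ⟨A, B⟩
    have h2 := Complex.norm_mul_sin_arg ⟨A, B⟩
    simp only at h1 h2
    rw [cos_sub]
    linear_combination -cos θ * h1 - sin θ * h2

lemma abs_integral_sin_mul_cos_le {L T δ X : ℝ} (hL : 0 < L) (hT : 2 * L ≤ T) (hX : 1 / 2 < X)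
    (hδ : X ≤ |δ|) (φ : ℝ) :
    |∫ t in (0 : ℝ)..T, sin (π * t / T) * cos (π / L * δ * t + φ)| ≤
      2 * T / π * ((2 * L / T) ^ 2 * (1 / (4 * X ^ 2 - 1))) := by
  have hT0 : 0 < T := by linarith
  have hπ := pi_pos
  set lam := π / L * δ with hlam
  set β := π / T with hβ
  have hβ0 : 0 < β := by positivity
  have hδ2 : X ^ 2 ≤ δ ^ 2 := by rw [← sq_abs δ]; gcongr
  have hX2 : 1 < 4 * X ^ 2 := by nlinarith
  have hLT : 4 * L ^ 2 ≤ T ^ 2 := by nlinarith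
  have hgap : π ^ 2 / (4 * L ^ 2) * (4 * X ^ 2 - 1) ≤ lam ^ 2 - β ^ 2 := by
    have h1 : lam ^ 2 = π ^ 2 / (4 * L ^ 2) * (4 * δ ^ 2) := by
      rw [hlam]; field_simp
    have h2 : β ^ 2 ≤ π ^ 2 / (4 * L ^ 2) := by
      rw [hβ, div_pow]; gcongr
    have h3 : π ^ 2 / (4 * L ^ 2) * (4 * X ^ 2) ≤ π ^ 2 / (4 * L ^ 2) * (4 * δ ^ 2) := by gcongr
    rw [h1]; linarith
  have hpos : 0 < π ^ 2 / (4 * L ^ 2) * (4 * X ^ 2 - 1) :=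
    mul_pos (by positivity) (by linarith)
  have hden : 0 < lam ^ 2 - β ^ 2 := hpos.trans_le hgap
  have h_int : ∫ t in (0 : ℝ)..T, sin (π * t / T) * cos (lam * t + φ) =
      -β * (cos (lam * T + φ) + cos φ) / (lam ^ 2 - β ^ 2) := by
    have hd : ∀ t ∈ uIcc 0 T, HasDerivAt (fun t => (lam * (sin (β * t) * sin (lam * t + φ)) +
        β * (cos (β * t) * cos (lam * t + φ))) / (lam ^ 2 - β ^ 2))
        (sin (π * t / T) * cos (lam * t + φ)) t := by
      intro t _
      have e1 : HasDerivAt (fun t => β * t) β t := by simpa using (hasDerivAt_id t).const_mul β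
      have e2 : HasDerivAt (fun t => lam * t + φ) lam t := by
        simpa using ((hasDerivAt_id t).const_mul lam).add_const φ
      have := ((((e1.sin).mul (e2.sin)).const_mul lam).add
        (((e1.cos).mul (e2.cos)).const_mul β)).div_const (lam ^ 2 - β ^ 2)
      refine this.congr_deriv ?_
      have e3 : π * t / T = β * t := by rw [hβ]; ring
      rw [e3]
      field_simp
      ring
    rw [intervalIntegral.integral_eq_sub_of_hasDerivAt hd
      (Continuous.intervalIntegrable (by fun_prop) _ _)]
    have e4 : β * T = π := by rw [hβ]; field_simp
    simp only [e4, mul_zero, sin_pi, cos_pi, sin_zero, cos_zero, zero_add]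
    ring
  rw [h_int, abs_div, abs_of_pos hden, abs_mul, abs_neg, abs_of_pos hβ0]
  have hc : |cos (lam * T + φ) + cos φ| ≤ 2 := by
    have := abs_add_le (cos (lam * T + φ)) (cos φ)
    linarith [abs_cos_le_one (lam * T + φ), abs_cos_le_one φ]
  calc β * |cos (lam * T + φ) + cos φ| / (lam ^ 2 - β ^ 2)
      ≤ β * 2 / (π ^ 2 / (4 * L ^ 2) * (4 * X ^ 2 - 1)) := by gcongr
    _ = _ := by
      have : 4 * X ^ 2 - 1 ≠ 0 := by linarith
      rw [hβ]; field_simp; norm_num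

lemma integral_sin_pi_mul_div {T : ℝ} (hT : 0 < T) :
    ∫ t in (0 : ℝ)..T, sin (π * t / T) = 2 * T / π := by
  have h : ∀ t, sin (π * t / T) = sin (π / T * t) := fun t => by congr 1; ring
  simp only [h]
  rw [intervalIntegral.integral_comp_mul_left (fun x => sin x) (by positivity), integral_sin]
  have : π / T * T = π := by field_simp
  rw [this]
  simp
  ring

/-- Time averages of products of oscillations against the Ingham weight `sin (π t / T)`. -/
def inghamForm (T : ℝ) (r φ om : ℕ → ℝ) (i j : ℕ) : ℝ :=
  ∫ t in (0 : ℝ)..T, sin (π * t / T) * ((r i * cos (om i * t - φ i)) * (r j * cos (om j * t - φ j)))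

lemma inghamForm_eq (T : ℝ) (r φ om : ℕ → ℝ) (i j : ℕ) : inghamForm T r φ om i j =
    r i * r j / 2 * ((∫ t in (0 : ℝ)..T, sin (π * t / T) * cos ((om i - om j) * t + (φ j - φ i))) +
      ∫ t in (0 : ℝ)..T, sin (π * t / T) * cos ((om i + om j) * t + (-φ i - φ j))) := by
  rw [inghamForm, ← intervalIntegral.integral_add
    (Continuous.intervalIntegrable (by fun_prop) _ _)
    (Continuous.intervalIntegrable (by fun_prop) _ _), ← intervalIntegral.integral_const_mul]
  congr 1; ext t
  have h1 : (om i - om j) * t + (φ j - φ i) = (om i * t - φ i) - (om j * t - φ j) := by ring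
  have h2 : (om i + om j) * t + (-φ i - φ j) = (om i * t - φ i) + (om j * t - φ j) := by ring
  rw [h1, h2, cos_sub (om i * t - φ i), cos_add (om i * t - φ i)]
  ring

lemma abs_inghamForm_le {L T X Z : ℝ} (hL : 0 < L) (hT : 2 * L ≤ T) (r φ W : ℕ → ℝ) {i j : ℕ}
    (hX : 1 / 2 < X) (hXW : X ≤ |W i - W j|) (hZ : 1 / 2 < Z) (hZW : Z ≤ |W i + W j|) :
    |inghamForm T r φ (fun k => π / L * W k) i j| ≤
      T / π * (2 * L / T) ^ 2 *
        (|r i| * |r j| * (1 / (4 * X ^ 2 - 1) + 1 / (4 * Z ^ 2 - 1))) := by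
  have h1 := abs_integral_sin_mul_cos_le hL hT hX hXW (φ j - φ i)
  have h2 := abs_integral_sin_mul_cos_le hL hT hZ hZW (-φ i - φ j)
  rw [inghamForm_eq]
  simp only [← mul_sub, ← mul_add]
  rw [abs_mul, abs_div, abs_mul, abs_two]
  calc _ ≤ |r i| * |r j| / 2 * (2 * T / π * ((2 * L / T) ^ 2 * (1 / (4 * X ^ 2 - 1))) +
        2 * T / π * ((2 * L / T) ^ 2 * (1 / (4 * Z ^ 2 - 1)))) := by
        gcongr
        exact (abs_add_le _ _).trans (add_le_add h1 h2)
    _ = _ := by ring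

lemma le_inghamForm_self {L T : ℝ} (hL : 0 < L) (hT : 2 * L ≤ T) (r φ W : ℕ → ℝ) {i : ℕ}
    (hW : 2 ≤ W i) :
    T / π * (r i ^ 2 * (1 - (2 * L / T) ^ 2 / 63)) ≤
      inghamForm T r φ (fun k => π / L * W k) i i := by
  have h2 := abs_integral_sin_mul_cos_le hL hT (X := 4) (δ := W i + W i) (by norm_num)
    (by rw [abs_of_nonneg] <;> linarith) (-φ i - φ i)
  rw [inghamForm_eq]
  simp only [← mul_add, sub_self, zero_mul, add_zero, cos_zero, mul_one]
  rw [integral_sin_pi_mul_div (by linarith)]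
  have h3 := (abs_le.1 h2).1
  have h4 : 0 ≤ r i * r i / 2 := by nlinarith [sq_nonneg (r i)]
  have h5 := mul_le_mul_of_nonneg_left h3 h4
  norm_num at h5 ⊢
  have e : r i * r i / 2 * (2 * T / π * ((2 * L / T) ^ 2 * (1 / 63))) =
      T / π * (r i ^ 2 * ((2 * L / T) ^ 2 / 63)) := by ring
  have e2 : r i * r i / 2 * (2 * T / π) = T / π * r i ^ 2 := by ring
  rw [mul_add, mul_sub, mul_one, e2, mul_sub]
  norm_num at e
  linarith

/-- Bound for the interaction of two modes at index distance `n`, the lower one being well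
separated from its successors. -/
def separatedKernel (n : ℝ) : ℝ := 1 / (4 * n ^ 2 - 1) + 1 / (4 * (n + 4) ^ 2 - 1)

/-- Bound for the interaction of two modes at index distance `n`, only the upper one being well
separated from its successors. -/
def weakKernel (n : ℝ) : ℝ :=
  1 / (4 * (n * (n + 2) / (2 * (n + 1))) ^ 2 - 1) + 1 / (4 * (n + 4) ^ 2 - 1)

lemma separatedKernel_sq_le {n : ℝ} (hn : 1 ≤ n) :
    separatedKernel n ^ 2 ≤ 15 / 100 * (1 / n ^ 3 - 1 / (n + 1) ^ 3) := by
  obtain ⟨m, hm, rfl⟩ : ∃ m : ℝ, 0 ≤ m ∧ n = m + 1 := ⟨n - 1, by linarith, by ring⟩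
  have h1 : 4 * (m + 1) ^ 2 - 1 = (2 * m + 1) * (2 * m + 3) := by ring
  have h2 : 4 * (m + 1 + 4) ^ 2 - 1 = (2 * m + 9) * (2 * m + 11) := by ring
  rw [separatedKernel, h1, h2, div_add_div _ _ (by positivity) (by positivity), div_pow,
    div_sub_div _ _ (by positivity) (by positivity), div_mul_div_comm,
    div_le_div_iff₀ (by positivity) (by positivity), ← sub_nonneg]
  ring_nf
  positivity

lemma weakKernel_sq_le {n : ℝ} (hn : 1 ≤ n) :
    weakKernel n ^ 2 ≤ 76 / 100 * (1 / n ^ 3 - 1 / (n + 1) ^ 3) := by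
  obtain ⟨m, hm, rfl⟩ : ∃ m : ℝ, 0 ≤ m ∧ n = m + 1 := ⟨n - 1, by linarith, by ring⟩
  have h1 : 1 / (4 * ((m + 1) * (m + 1 + 2) / (2 * (m + 1 + 1))) ^ 2 - 1) =
      (m + 2) ^ 2 / ((m ^ 2 + 5 * m + 5) * (m ^ 2 + 3 * m + 1)) := by
    have : 4 * ((m + 1) * (m + 1 + 2) / (2 * (m + 1 + 1))) ^ 2 - 1 =
        ((m ^ 2 + 5 * m + 5) * (m ^ 2 + 3 * m + 1)) / (m + 2) ^ 2 := by
      have : m + 2 ≠ 0 := by positivity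
      have : m + 1 + 1 ≠ 0 := by positivity
      field_simp
      ring
    rw [this, one_div_div]
  have h2 : 4 * (m + 1 + 4) ^ 2 - 1 = (2 * m + 9) * (2 * m + 11) := by ring
  rw [weakKernel, h1, h2, div_add_div _ _ (by positivity) (by positivity), div_pow,
    div_sub_div _ _ (by positivity) (by positivity), div_mul_div_comm,
    div_le_div_iff₀ (by positivity) (by positivity), ← sub_nonneg]
  ring_nf
  positivity

lemma inv_cube_sub_nonneg {n : ℝ} (hn : 1 ≤ n) : 0 ≤ 1 / n ^ 3 - 1 / (n + 1) ^ 3 := by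
  have : 1 / (n + 1) ^ 3 ≤ 1 / n ^ 3 := by gcongr; linarith
  linarith

lemma sum_inv_cube_sub_le_one (S : Finset ℕ) (d : ℕ → ℕ) (hd : ∀ j ∈ S, 1 ≤ d j)
    (hinj : InjOn d S) :
    ∑ j ∈ S, (1 / (d j : ℝ) ^ 3 - 1 / ((d j : ℝ) + 1) ^ 3) ≤ 1 := by
  obtain ⟨N, hN⟩ := (S.image d).exists_nat_subset_range
  have hsub : S.image d ⊆ (Finset.range N).image (· + 1) := by
    intro n hn
    obtain ⟨j, hj, rfl⟩ := Finset.mem_image.1 hn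
    have h1 := hd j hj
    have h2 := Finset.mem_range.1 (hN hn)
    exact Finset.mem_image.2 ⟨d j - 1, Finset.mem_range.2 (by omega), by omega⟩
  rw [← Finset.sum_image (f := fun n : ℕ => 1 / (n : ℝ) ^ 3 - 1 / ((n : ℝ) + 1) ^ 3) hinj]
  refine (Finset.sum_le_sum_of_subset_of_nonneg hsub fun n hn _ => ?_).trans ?_
  · obtain ⟨m, -, rfl⟩ := Finset.mem_image.1 hn
    exact inv_cube_sub_nonneg (by simp)
  · rw [Finset.sum_image (by intro a _ b _ h; simpa using h)]
    have := Finset.sum_range_sub' (fun m : ℕ => 1 / ((m : ℝ) + 1) ^ 3) N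
    push_cast at this ⊢
    rw [this]
    have : (0 : ℝ) ≤ 1 / ((N : ℝ) + 1) ^ 3 := by positivity
    simp only [zero_add, one_pow, div_one]
    linarith

/-- Interaction bound for the modes `i` and `j`, where `g` is the set of well separated modes. -/
def pairKernel (g : ℕ → Prop) [DecidablePred g] (i j : ℕ) : ℝ :=
  if g (min i j) then separatedKernel (Nat.dist i j) else weakKernel (Nat.dist i j)

lemma pairKernel_comm (g : ℕ → Prop) [DecidablePred g] (i j : ℕ) :
    pairKernel g i j = pairKernel g j i := by
  simp only [pairKernel, min_comm, Nat.dist_comm]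

lemma one_le_dist {i j : ℕ} (h : i ≠ j) : (1 : ℝ) ≤ (Nat.dist i j : ℕ) := by
  have : 0 < Nat.dist i j := Nat.dist_pos_of_ne h
  exact_mod_cast this

lemma pairKernel_sq_le (g : ℕ → Prop) [DecidablePred g] {i j : ℕ} (h : i ≠ j) :
    pairKernel g i j ^ 2 ≤
      76 / 100 * (1 / (Nat.dist i j : ℝ) ^ 3 - 1 / ((Nat.dist i j : ℝ) + 1) ^ 3) := by
  have h1 := one_le_dist h
  unfold pairKernel
  split_ifs
  · refine (separatedKernel_sq_le h1).trans ?_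
    gcongr
    · exact inv_cube_sub_nonneg h1
    · norm_num
  · exact weakKernel_sq_le h1

lemma sum_inv_cube_dist_lt_le_one (I : Finset ℕ) (i : ℕ) : ∑ j ∈ I with i < j,
    (1 / (Nat.dist i j : ℝ) ^ 3 - 1 / ((Nat.dist i j : ℝ) + 1) ^ 3) ≤ 1 := by
  refine sum_inv_cube_sub_le_one _ (Nat.dist i) (fun j hj => ?_) fun a ha b hb h => ?_
  · exact Nat.dist_pos_of_ne (Finset.mem_filter.1 hj).2.ne
  · have h1 := (Finset.mem_filter.1 ha).2
    have h2 := (Finset.mem_filter.1 hb).2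
    rw [Nat.dist_eq_sub_of_le h1.le, Nat.dist_eq_sub_of_le h2.le] at h
    omega

lemma sum_inv_cube_dist_gt_le_one (I : Finset ℕ) (i : ℕ) : ∑ j ∈ I with j < i,
    (1 / (Nat.dist i j : ℝ) ^ 3 - 1 / ((Nat.dist i j : ℝ) + 1) ^ 3) ≤ 1 := by
  refine sum_inv_cube_sub_le_one _ (Nat.dist i) (fun j hj => ?_) fun a ha b hb h => ?_
  · exact Nat.dist_pos_of_ne (Finset.mem_filter.1 hj).2.ne'
  · have h1 := (Finset.mem_filter.1 ha).2
    have h2 := (Finset.mem_filter.1 hb).2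
    rw [Nat.dist_eq_sub_of_le_right h1.le, Nat.dist_eq_sub_of_le_right h2.le] at h
    omega

lemma sum_pairKernel_sq_le (g : ℕ → Prop) [DecidablePred g] (hg : ∀ i j, i < j → g i → g j)
    (I : Finset ℕ) (i : ℕ) :
    ∑ j ∈ I.erase i, (if g i ∨ g j then pairKernel g i j else 0) ^ 2 ≤
      if g i then 91 / 100 else 76 / 100 := by
  set H : ℕ → ℝ := fun j => 1 / (Nat.dist i j : ℝ) ^ 3 - 1 / ((Nat.dist i j : ℝ) + 1) ^ 3 with hH
  set cu : ℝ := if g i then 15 / 100 else 76 / 100 with hcu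
  set cd : ℝ := if g i then 76 / 100 else 0 with hcd
  have hcu0 : 0 ≤ cu := by rw [hcu]; split_ifs <;> norm_num
  have hcd0 : 0 ≤ cd := by rw [hcd]; split_ifs <;> norm_num
  have hterm : ∀ j ∈ I.erase i, (if g i ∨ g j then pairKernel g i j else 0) ^ 2 ≤
      (if i < j then cu * H j else 0) + (if j < i then cd * H j else 0) := by
    intro j hj
    have hne : i ≠ j := (Finset.ne_of_mem_erase hj).symm
    have h1 := one_le_dist hne
    have hHj : 0 ≤ H j := inv_cube_sub_nonneg h1
    have hle : pairKernel g i j ^ 2 ≤ 76 / 100 * H j := pairKernel_sq_le g hne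
    rcases lt_or_gt_of_ne hne with hlt | hlt
    · rw [if_pos hlt, if_neg hlt.not_gt, add_zero]
      by_cases hi : g i
      · simp only [hi, true_or, if_true, pairKernel, min_eq_left hlt.le, hcu]
        exact separatedKernel_sq_le h1
      · simp only [hi, false_or, if_false, hcu]
        split_ifs
        · exact hle
        · norm_num; positivity
    · rw [if_neg hlt.not_gt, if_pos hlt, zero_add]
      by_cases hi : g i
      · simp only [hi, true_or, if_true, hcd]
        exact hle
      · have hj : ¬ g j := fun h => hi (hg j i hlt h)
        simp [hi, hj, hcd]
  refine (Finset.sum_le_sum hterm).trans ?_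
  rw [Finset.sum_add_distrib, ← Finset.sum_filter, ← Finset.sum_filter, ← Finset.mul_sum,
    ← Finset.mul_sum]
  have h1 := mul_le_mul_of_nonneg_left (sum_inv_cube_dist_lt_le_one (I.erase i) i) hcu0
  have h2 := mul_le_mul_of_nonneg_left (sum_inv_cube_dist_gt_le_one (I.erase i) i) hcd0
  refine (add_le_add h1 h2).trans ?_
  rw [hcu, hcd]
  split_ifs <;> norm_num

lemma sum_abs_mul_pairKernel_le (g : ℕ → Prop) [DecidablePred g]
    (hg : ∀ i j, i < j → g i → g j) (I : Finset ℕ) (i : ℕ) (s : ℕ → ℝ)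
    (hs : ∑ j ∈ I.erase i, s j ^ 2 ≤ 1 / 4) :
    ∑ j ∈ I.erase i, |s j| * (if g i ∨ g j then pairKernel g i j else 0) ≤
      if g i then 48 / 100 else 44 / 100 := by
  have h1 := Finset.sum_mul_sq_le_sq_mul_sq (I.erase i) (fun j => |s j|)
    (fun j => if g i ∨ g j then pairKernel g i j else 0)
  have h2 := sum_pairKernel_sq_le g hg I i
  simp only [sq_abs] at h1
  have h3 := h1.trans (mul_le_mul hs h2 (Finset.sum_nonneg fun j _ => sq_nonneg _) (by norm_num))
  refine (le_abs_self _).trans (abs_le_of_sq_le_sq (h3.trans ?_) ?_)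
  all_goals split_ifs <;> norm_num

/-- The scaled frequencies `W k` of a Klein–Gordon type family. -/
structure KleinGordon (A M : ℝ) (W : ℕ → ℝ) : Prop where
  one_le : 1 ≤ A
  succ_le : ∀ k : ℕ, (k : ℝ) + 1 ≤ W k
  sq_eq : ∀ k : ℕ, W k ^ 2 = A * (k : ℝ) ^ 2 + M

namespace KleinGordon

variable {A M : ℝ} {W : ℕ → ℝ}

lemma pos (h : KleinGordon A M W) (k : ℕ) : 0 < W k := by
  linarith [h.succ_le k, Nat.cast_nonneg (α := ℝ) k]

lemma monotone (h : KleinGordon A M W) {i j : ℕ} (hij : i < j) : W i ≤ W j := by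
  have h1 : (i : ℝ) < j := by exact_mod_cast hij
  have := h.one_le
  refine le_of_sq_le_sq ?_ (h.pos j).le
  rw [h.sq_eq, h.sq_eq]
  gcongr

lemma separated_mono (h : KleinGordon A M W) {i j : ℕ} (hij : i < j) (hi : W i ≤ A * i) :
    W j ≤ A * j := by
  have h1 : (i : ℝ) < j := by exact_mod_cast hij
  have h0 := h.one_le
  have h2 : W i ^ 2 ≤ (A * i) ^ 2 := by
    have := (h.pos i).le
    gcongr
  have h3 := h.sq_eq i
  have h4 := h.sq_eq j
  have h5 : (i : ℝ) ^ 2 ≤ (j : ℝ) ^ 2 := by gcongr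
  refine le_of_sq_le_sq ?_ (by positivity)
  nlinarith [mul_nonneg (mul_nonneg (by linarith : (0 : ℝ) ≤ A) (sub_nonneg.2 h0))
    (sub_nonneg.2 h5)]

lemma sub_le_of_separated (h : KleinGordon A M W) {i j : ℕ} (hij : i < j) (hi : W i ≤ A * i) :
    (j : ℝ) - i ≤ W j - W i := by
  have h1 : (i : ℝ) < j := by exact_mod_cast hij
  have h0 := h.one_le
  have hj := h.separated_mono hij hi
  have h3 := h.sq_eq i
  have h4 := h.sq_eq j
  have hp := h.pos i
  have hq := h.pos j
  have hm := h.monotone hij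
  have hi0 : (0 : ℝ) ≤ i := Nat.cast_nonneg i
  refine le_of_mul_le_mul_right ?_ (by nlinarith : 0 < A * (j + i))
  calc ((j : ℝ) - i) * (A * (j + i)) = (W j - W i) * (W j + W i) := by linarith
    _ ≤ (W j - W i) * (A * (j + i)) :=
      mul_le_mul_of_nonneg_left (by linarith) (by linarith)

lemma weak_gap_le (h : KleinGordon A M W) {i j : ℕ} (hi : 1 ≤ i) (hij : i < j)
    (hj : W j ≤ A * j) :
    ((j : ℝ) - i) * ((j - i) + 2) / (2 * ((j - i) + 1)) ≤ W j - W i := by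
  have h1 : (i : ℝ) < j := by exact_mod_cast hij
  have hi1 : (1 : ℝ) ≤ i := by exact_mod_cast hi
  have h0 := h.one_le
  have h3 := h.sq_eq i
  have h4 := h.sq_eq j
  have hp := h.pos i
  have hq := h.pos j
  have hm := h.monotone hij
  have hA : 0 < A := by linarith
  have e1 : A * (((j : ℝ) - i) * (j + i)) ≤ A * ((W j - W i) * (2 * j)) := by
    calc A * (((j : ℝ) - i) * (j + i)) = (W j - W i) * (W j + W i) := by linarith
      _ ≤ (W j - W i) * (2 * (A * j)) :=
        mul_le_mul_of_nonneg_left (by linarith) (by linarith)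
      _ = _ := by ring
  have e2 := le_of_mul_le_mul_left e1 hA
  have hn : 0 < (j : ℝ) - i := by linarith
  rw [div_le_iff₀ (by linarith)]
  have hj0 : (0 : ℝ) < j := by linarith
  refine le_of_mul_le_mul_right ?_ hj0
  have e3 : ((j : ℝ) - i + 2) * j ≤ (j + i) * ((j : ℝ) - i + 1) := by nlinarith
  calc ((j : ℝ) - i) * (j - i + 2) * j = (j - i) * ((j - i + 2) * j) := by ring
    _ ≤ (j - i) * ((j + i) * (j - i + 1)) := by gcongr
    _ = ((j - i) * (j + i)) * (j - i + 1) := by ring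
    _ ≤ ((W j - W i) * (2 * j)) * (j - i + 1) := by gcongr
    _ = _ := by ring

open Classical in
lemma abs_inghamForm_le_of_lt (h : KleinGordon A M W) {L T : ℝ} (hL : 0 < L) (hT : 2 * L ≤ T)
    (r φ : ℕ → ℝ) {i j : ℕ} (hi : 1 ≤ i) (hij : i < j) (hg : W i ≤ A * i ∨ W j ≤ A * j) :
    |inghamForm T r φ (fun k => π / L * W k) i j| ≤
      T / π * (2 * L / T) ^ 2 * (|r i| * |r j| * pairKernel (fun k => W k ≤ A * k) i j) := by
  have hd : ((Nat.dist i j : ℕ) : ℝ) = j - i := by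
    rw [Nat.dist_eq_sub_of_le hij.le, Nat.cast_sub hij.le]
  have hi1 : (1 : ℝ) ≤ i := by exact_mod_cast hi
  have hn : (1 : ℝ) ≤ (j : ℝ) - i := by
    have : (i : ℝ) + 1 ≤ j := by exact_mod_cast hij
    linarith
  have hm := h.monotone hij
  have hs : ((j : ℝ) - i) + 4 ≤ |W i + W j| := by
    refine le_trans ?_ (le_abs_self _)
    linarith [h.succ_le i, h.succ_le j]
  have habs : |W i - W j| = W j - W i := by
    rw [abs_sub_comm]; exact abs_of_nonneg (by linarith)
  unfold pairKernel
  rw [min_eq_left hij.le, hd]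
  split_ifs with hgi
  · exact abs_inghamForm_le hL hT r φ W (by linarith)
      (habs ▸ h.sub_le_of_separated hij hgi) (by linarith) hs
  · refine abs_inghamForm_le hL hT r φ W ?_
      (habs ▸ h.weak_gap_le hi hij (hg.resolve_left hgi)) (by linarith) hs
    rw [lt_div_iff₀ (by linarith)]
    nlinarith

lemma inghamForm_comm (T : ℝ) (r φ om : ℕ → ℝ) (i j : ℕ) :
    inghamForm T r φ om i j = inghamForm T r φ om j i := by
  simp only [inghamForm, mul_comm (r i * _)]

open Classical in
lemma abs_inghamForm_le_of_ne (h : KleinGordon A M W) {L T : ℝ} (hL : 0 < L) (hT : 2 * L ≤ T)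
    (r φ : ℕ → ℝ) {i j : ℕ} (hi : 1 ≤ i) (hj : 1 ≤ j) (hij : i ≠ j)
    (hg : W i ≤ A * i ∨ W j ≤ A * j) :
    |inghamForm T r φ (fun k => π / L * W k) i j| ≤
      T / π * (2 * L / T) ^ 2 * (|r i| * |r j| * pairKernel (fun k => W k ≤ A * k) i j) := by
  rcases lt_or_gt_of_ne hij with hlt | hlt
  · exact h.abs_inghamForm_le_of_lt hL hT r φ hi hlt hg
  · rw [inghamForm_comm, pairKernel_comm, mul_comm |r i|]
    exact h.abs_inghamForm_le_of_lt hL hT r φ hj hlt hg.symm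

open Classical in
/-- Lower bound for a quadratic form built from a Gram matrix `s` and the Ingham averages. -/
lemma le_sum_gram_mul_inghamForm (h : KleinGordon A M W) {L T : ℝ} (hL : 0 < L)
    (hT : 2 * L ≤ T) (r φ : ℕ → ℝ) {I : Finset ℕ} (hI : ∀ i ∈ I, 1 ≤ i) (s : ℕ → ℕ → ℝ)
    (hsymm : ∀ i j, s i j = s j i) (hs0 : ∀ i ∈ I, 0 ≤ s i i) (hs1 : ∀ i ∈ I, s i i ≤ 1)
    (hs : ∀ i ∈ I, ∑ j ∈ I.erase i, s i j ^ 2 ≤ 1 / 4) :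
    T / π * ∑ i ∈ I, r i ^ 2 * (if W i ≤ A * i then s i i - 1 / 2 * (2 * L / T) ^ 2
        else - (44 / 100 * (2 * L / T) ^ 2)) ≤
      ∑ i ∈ I, ∑ j ∈ I, if W i ≤ A * i ∨ W j ≤ A * j then
        s i j * inghamForm T r φ (fun k => π / L * W k) i j else 0 := by
  have hT0 : 0 < T := by linarith
  have hπ := pi_pos
  set y := (2 * L / T) ^ 2 with hy
  have hy0 : 0 ≤ y := sq_nonneg _
  set g : ℕ → Prop := fun k => W k ≤ A * k with hgdef
  set P : ℕ → ℕ → ℝ := fun i j =>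
    if i = j then 0 else |s i j| * (if g i ∨ g j then pairKernel g i j else 0) with hP
  have hPsymm : ∀ i j, P i j = P j i := fun i j => by
    simp only [hP, hsymm i j, pairKernel_comm g i j, eq_comm (a := i), or_comm (a := g i)]
  have hPnn : ∀ i ∈ I, ∀ j ∈ I, 0 ≤ P i j := by
    intro i _ j _
    simp only [hP]
    split_ifs with h1 h2
    · exact le_rfl
    · refine mul_nonneg (abs_nonneg _) ?_
      have h3 := one_le_dist h1
      have key : ∀ x : ℝ, 1 / 2 < x → 0 ≤ 1 / (4 * x ^ 2 - 1) := fun x hx =>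
        one_div_nonneg.2 (by nlinarith)
      unfold pairKernel separatedKernel weakKernel
      split_ifs
      · exact add_nonneg (key _ (by linarith)) (key _ (by linarith))
      · refine add_nonneg (key _ ?_) (key _ (by linarith))
        rw [lt_div_iff₀ (by linarith)]
        nlinarith
    · simp
  have hrow : ∀ i ∈ I, ∑ j ∈ I, P i j ≤ if g i then 48 / 100 else 44 / 100 := by
    intro i hi
    rw [← Finset.add_sum_erase I _ hi]
    simp only [hP, if_true, zero_add]
    rw [Finset.sum_congr rfl (g := fun j => |s i j| * (if g i ∨ g j then pairKernel g i j else 0))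
      fun j hj => if_neg (Finset.ne_of_mem_erase hj).symm]
    exact sum_abs_mul_pairKernel_le g (fun i j hij => h.separated_mono hij) I i (s i) (hs i hi)
  have hterm : ∀ i ∈ I, ∀ j ∈ I,
      (if i = j then (if g i then T / π * (r i ^ 2 * (s i i - y / 63)) else 0) else 0) -
        T / π * y * ((r i ^ 2 + r j ^ 2) / 2 * P i j) ≤
      if g i ∨ g j then s i j * inghamForm T r φ (fun k => π / L * W k) i j else 0 := by
    intro i hi j hj
    by_cases hij : i = j
    · subst hij
      simp only [hP, if_true, or_self, mul_zero, sub_zero]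
      split_ifs with hgi
      · have h1 : (1 : ℝ) ≤ i := by exact_mod_cast hI i hi
        have h2 := le_inghamForm_self hL hT r φ W (i := i) (by linarith [h.succ_le i])
        have h3 := mul_le_mul_of_nonneg_left h2 (hs0 i hi)
        refine le_trans ?_ h3
        have h4 : r i ^ 2 * (s i i - y / 63) ≤ r i ^ 2 * (s i i * (1 - y / 63)) := by
          gcongr
          nlinarith [hs1 i hi]
        calc _ ≤ T / π * (r i ^ 2 * (s i i * (1 - y / 63))) := by gcongr
          _ = _ := by ring
      · exact le_rfl
    · simp only [hP, if_neg hij, zero_sub]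
      split_ifs with hgij
      · have h1 := h.abs_inghamForm_le_of_ne hL hT r φ (hI i hi) (hI j hj) hij hgij
        have hk : 0 ≤ |s i j| * pairKernel g i j := by
          simpa [hP, hij, hgij] using hPnn i hi j hj
        rw [neg_le]
        refine (neg_le_abs _).trans ?_
        rw [abs_mul]
        calc _ ≤ |s i j| * (T / π * y * (|r i| * |r j| * pairKernel g i j)) := by gcongr
          _ = T / π * y * ((|r i| * |r j|) * (|s i j| * pairKernel g i j)) := by ring
          _ ≤ _ := by
            gcongr
            nlinarith [sq_nonneg (|r i| - |r j|), sq_abs (r i), sq_abs (r j)]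
      · simp
  refine le_trans ?_ (Finset.sum_le_sum fun i hi => Finset.sum_le_sum fun j hj => hterm i hi j hj)
  simp only [Finset.sum_sub_distrib]
  have hdiag : ∑ i ∈ I, ∑ j ∈ I,
      (if i = j then (if g i then T / π * (r i ^ 2 * (s i i - y / 63)) else 0) else 0) =
      ∑ i ∈ I, (if g i then T / π * (r i ^ 2 * (s i i - y / 63)) else 0) := by
    refine Finset.sum_congr rfl fun i hi => ?_
    rw [Finset.sum_ite_eq, if_pos hi]
  have hoff : ∑ i ∈ I, ∑ j ∈ I, T / π * y * ((r i ^ 2 + r j ^ 2) / 2 * P i j) =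
      ∑ i ∈ I, T / π * y * (r i ^ 2 * ∑ j ∈ I, P i j) := by
    have e1 : ∑ i ∈ I, ∑ j ∈ I, r j ^ 2 * P i j = ∑ i ∈ I, ∑ j ∈ I, r i ^ 2 * P i j := by
      rw [Finset.sum_comm]
      exact Finset.sum_congr rfl fun i _ => Finset.sum_congr rfl fun j _ => by rw [hPsymm]
    simp only [← Finset.mul_sum]
    congr 1
    calc ∑ i ∈ I, ∑ j ∈ I, (r i ^ 2 + r j ^ 2) / 2 * P i j
        = 1 / 2 * (∑ i ∈ I, ∑ j ∈ I, r i ^ 2 * P i j + ∑ i ∈ I, ∑ j ∈ I, r j ^ 2 * P i j) := by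
          simp only [← Finset.sum_add_distrib, Finset.mul_sum]
          exact Finset.sum_congr rfl fun i _ => Finset.sum_congr rfl fun j _ => by ring
      _ = ∑ i ∈ I, ∑ j ∈ I, r i ^ 2 * P i j := by rw [e1]; ring
      _ = _ := by simp only [Finset.mul_sum]
  rw [hdiag, hoff, Finset.mul_sum, ← Finset.sum_sub_distrib]
  refine Finset.sum_le_sum fun i hi => ?_
  have h1 := hrow i hi
  have h2 : 0 ≤ T / π * y * r i ^ 2 := by positivity
  have h3 := mul_le_mul_of_nonneg_left h1 h2
  split_ifs at h1 h3 ⊢ with hgi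
  · linarith
  · linarith

end KleinGordon

open Classical in
lemma sum_separated_le_integral {ℓ : ℝ} {J : Set ℝ} (hJ : J ⊆ Ioo 0 ℓ) (I : Finset ℕ)
    (a : ℕ → ℝ) (g : ℕ → Prop) :
    ∑ i ∈ I, ∑ j ∈ I, (if g i ∨ g j then a i * a j * sineGram ℓ J i j else 0) ≤
      ∑ i ∈ I, ∑ j ∈ I, a i * a j * sineGram ℓ J i j := by
  have h0 : 0 ≤ ∑ i ∈ I with ¬ g i, ∑ j ∈ I with ¬ g j, a i * a j * sineGram ℓ J i j := by
    rw [← integral_sq_sum_sineMode hJ]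
    exact integral_nonneg fun x => sq_nonneg _
  simp only [Finset.sum_filter] at h0
  have : ∑ i ∈ I, ∑ j ∈ I, a i * a j * sineGram ℓ J i j =
      ∑ i ∈ I, ∑ j ∈ I, (if g i ∨ g j then a i * a j * sineGram ℓ J i j else 0) +
      ∑ i ∈ I, if ¬ g i then ∑ j ∈ I, if ¬ g j then a i * a j * sineGram ℓ J i j else 0 else 0 := by
    rw [← Finset.sum_add_distrib]
    refine Finset.sum_congr rfl fun i _ => ?_
    by_cases hi : g i
    · simp [hi]
    · simp only [hi, not_false_eq_true, if_true, false_or, ← Finset.sum_add_distrib]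
      refine Finset.sum_congr rfl fun j _ => ?_
      by_cases hj : g j <;> simp [hj]
  linarith

lemma sin_weight_nonneg {T t : ℝ} (hT : 0 < T) (ht : t ∈ Icc 0 T) :
    0 ≤ sin (π * t / T) := by
  refine sin_nonneg_of_nonneg_of_le_pi (by have := ht.1; have := pi_pos; positivity) ?_
  rw [div_le_iff₀ hT]
  have := ht.2
  gcongr

open Classical in
/-- Ingham type lower bound for the Klein–Gordon frequencies on one line. -/
lemma KleinGordon.le_integral {A M : ℝ} {W : ℕ → ℝ} (h : KleinGordon A M W) {L T : ℝ}
    (hL : 0 < L) (hT : 2 * L ≤ T) {ℓ : ℝ} (hℓ : 0 < ℓ) {J : Set ℝ} (hJ : J ⊆ Ioo 0 ℓ)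
    (r φ : ℕ → ℝ) {I : Finset ℕ} (hI : ∀ i ∈ I, 1 ≤ i) :
    T / π * ∑ i ∈ I, r i ^ 2 * (if W i ≤ A * i then
        sineGram ℓ J i i - 1 / 2 * (2 * L / T) ^ 2 else - (44 / 100 * (2 * L / T) ^ 2)) ≤
      ∫ t in (0 : ℝ)..T, sin (π * t / T) * ∑ i ∈ I, ∑ j ∈ I,
        (r i * cos (π / L * W i * t - φ i)) * (r j * cos (π / L * W j * t - φ j)) *
          sineGram ℓ J i j := by
  have hT0 : 0 < T := by linarith
  refine (h.le_sum_gram_mul_inghamForm hL hT r φ hI (sineGram ℓ J) (sineGram_comm ℓ J)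
    (fun i _ => sineGram_self_nonneg ℓ J i) (fun i hi => sineGram_self_le_one hℓ hJ (hI i hi))
    (fun i hi => sum_erase_sineGram_sq_le hℓ hJ hI hi)).trans ?_
  have h_int : ∑ i ∈ I, ∑ j ∈ I, (if W i ≤ A * i ∨ W j ≤ A * j then
        sineGram ℓ J i j * inghamForm T r φ (fun k => π / L * W k) i j else 0) =
      ∫ t in (0 : ℝ)..T, ∑ i ∈ I, ∑ j ∈ I, sin (π * t / T) *
        (if W i ≤ A * i ∨ W j ≤ A * j then
          (r i * cos (π / L * W i * t - φ i)) * (r j * cos (π / L * W j * t - φ j)) *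
          sineGram ℓ J i j else 0) := by
    have hc : ∀ i j, Continuous fun t : ℝ => sin (π * t / T) *
        (if W i ≤ A * i ∨ W j ≤ A * j then
          (r i * cos (π / L * W i * t - φ i)) * (r j * cos (π / L * W j * t - φ j)) *
          sineGram ℓ J i j else 0) := fun i j => by split_ifs <;> fun_prop
    rw [intervalIntegral.integral_finsetSum fun i _ =>
      (continuous_finsetSum _ fun j _ => hc i j).intervalIntegrable _ _]
    refine Finset.sum_congr rfl fun i _ => ?_
    rw [intervalIntegral.integral_finsetSum fun j _ => (hc i j).intervalIntegrable _ _]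
    refine Finset.sum_congr rfl fun j _ => ?_
    split_ifs
    · rw [inghamForm, ← intervalIntegral.integral_const_mul]
      congr 1; ext t; ring
    · simp
  rw [h_int]
  refine intervalIntegral.integral_mono_on hT0.le
    (Continuous.intervalIntegrable ?_ _ _) (Continuous.intervalIntegrable (by fun_prop) _ _) ?_
  · refine continuous_finsetSum _ fun i _ => continuous_finsetSum _ fun j _ => ?_
    split_ifs <;> fun_prop
  · intro t ht
    simp only [← Finset.mul_sum]
    refine mul_le_mul_of_nonneg_left ?_ ?_
    · exact sum_separated_le_integral hJ I (fun i => r i * cos (π / L * W i * t - φ i))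
        (fun i => W i ≤ A * i)
    · exact sin_weight_nonneg hT0 ht

/-- The frequencies of the rectangle, scaled by the length of its diagonal. -/
def diagFreq (ℓ₁ ℓ₂ : ℝ) (k : ℕ × ℕ) : ℝ :=
  √((ℓ₁ ^ 2 + ℓ₂ ^ 2) * ((k.1 : ℝ) ^ 2 / ℓ₁ ^ 2 + (k.2 : ℝ) ^ 2 / ℓ₂ ^ 2))

lemma diagFreq_sq (ℓ₁ ℓ₂ : ℝ) (k : ℕ × ℕ) : diagFreq ℓ₁ ℓ₂ k ^ 2 =
    (ℓ₁ ^ 2 + ℓ₂ ^ 2) * ((k.1 : ℝ) ^ 2 / ℓ₁ ^ 2 + (k.2 : ℝ) ^ 2 / ℓ₂ ^ 2) :=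
  sq_sqrt (by positivity)

lemma diagFreq_swap (ℓ₁ ℓ₂ : ℝ) (i j : ℕ) : diagFreq ℓ₁ ℓ₂ (i, j) = diagFreq ℓ₂ ℓ₁ (j, i) := by
  unfold diagFreq
  congr 1
  ring

lemma add_le_diagFreq {ℓ₁ ℓ₂ : ℝ} (h₁ : 0 < ℓ₁) (h₂ : 0 < ℓ₂) (k : ℕ × ℕ) :
    (k.1 : ℝ) + k.2 ≤ diagFreq ℓ₁ ℓ₂ k := by
  refine le_sqrt_of_sq_le ?_
  have : (ℓ₁ ^ 2 + ℓ₂ ^ 2) * ((k.1 : ℝ) ^ 2 / ℓ₁ ^ 2 + (k.2 : ℝ) ^ 2 / ℓ₂ ^ 2) -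
      ((k.1 : ℝ) + k.2) ^ 2 = (ℓ₂ / ℓ₁ * k.1 - ℓ₁ / ℓ₂ * k.2) ^ 2 := by
    field_simp
    ring
  nlinarith [sq_nonneg (ℓ₂ / ℓ₁ * k.1 - ℓ₁ / ℓ₂ * k.2)]

lemma kleinGordon_diagFreq {ℓ₁ ℓ₂ : ℝ} (h₁ : 0 < ℓ₁) (h₂ : 0 < ℓ₂) {q : ℕ} (hq : 1 ≤ q) :
    KleinGordon ((ℓ₁ ^ 2 + ℓ₂ ^ 2) / ℓ₁ ^ 2) ((ℓ₁ ^ 2 + ℓ₂ ^ 2) * ((q : ℝ) ^ 2 / ℓ₂ ^ 2))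
      (fun k => diagFreq ℓ₁ ℓ₂ (k, q)) where
  one_le := by
    rw [le_div_iff₀ (by positivity)]
    nlinarith [sq_nonneg ℓ₂]
  succ_le k := by
    have := add_le_diagFreq h₁ h₂ (k, q)
    have hq1 : (1 : ℝ) ≤ q := by exact_mod_cast hq
    simp only at this
    linarith
  sq_eq k := by
    rw [diagFreq_sq]
    ring

lemma diagFreq_le_of_le {ℓ₁ ℓ₂ : ℝ} (h₁ : 0 < ℓ₁) (h₂ : 0 < ℓ₂) {i j : ℕ}
    (h : ℓ₁ ^ 2 * j ≤ ℓ₂ ^ 2 * i) :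
    diagFreq ℓ₁ ℓ₂ (i, j) ≤ (ℓ₁ ^ 2 + ℓ₂ ^ 2) / ℓ₁ ^ 2 * i := by
  refine le_of_sq_le_sq ?_ (by positivity)
  rw [diagFreq_sq]
  have h3 : (j : ℝ) ≤ ℓ₂ ^ 2 * i / ℓ₁ ^ 2 := by
    rw [le_div_iff₀ (by positivity)]; linarith
  calc (ℓ₁ ^ 2 + ℓ₂ ^ 2) * ((i : ℝ) ^ 2 / ℓ₁ ^ 2 + (j : ℝ) ^ 2 / ℓ₂ ^ 2)
      ≤ (ℓ₁ ^ 2 + ℓ₂ ^ 2) * ((i : ℝ) ^ 2 / ℓ₁ ^ 2 + (ℓ₂ ^ 2 * i / ℓ₁ ^ 2) ^ 2 / ℓ₂ ^ 2) := by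
        gcongr
    _ = _ := by field_simp

lemma om_eq {ℓ₁ ℓ₂ : ℝ} (h₁ : 0 < ℓ₁) (k : ℕ × ℕ) :
    om ℓ₁ ℓ₂ k = π / √(ℓ₁ ^ 2 + ℓ₂ ^ 2) * diagFreq ℓ₁ ℓ₂ k := by
  have : √(ℓ₁ ^ 2 + ℓ₂ ^ 2) ≠ 0 := by positivity
  unfold om gam diagFreq
  rw [sqrt_mul (by positivity), sqrt_mul (by positivity), sqrt_sq pi_pos.le]
  field_simp

lemma phiR_eq {ℓ₁ ℓ₂ : ℝ} (h₁ : 0 < ℓ₁) (k : ℕ × ℕ) (p : ℝ × ℝ) :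
    phiR ℓ₁ ℓ₂ k p = sineMode ℓ₁ k.1 p.1 * sineMode ℓ₂ k.2 p.2 := by
  have h : √(2 / ℓ₁) * √(2 / ℓ₂) = 2 / √(ℓ₁ * ℓ₂) := by
    rw [← sqrt_mul (by positivity), div_mul_div_comm, sqrt_div (by norm_num),
      sqrt_mul_self (by norm_num)]
  unfold phiR sineMode
  rw [← h]
  ring

@[fun_prop]
lemma continuous_phiR (ℓ₁ ℓ₂ : ℝ) (k : ℕ × ℕ) : Continuous (phiR ℓ₁ ℓ₂ k) := by
  unfold phiR; fun_prop

lemma Continuous.integrableOn_of_subset_rectangle {f : ℝ × ℝ → ℝ} (hf : Continuous f)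
    {S : Set (ℝ × ℝ)} {ℓ₁ ℓ₂ : ℝ} (hS : S ⊆ Ioo 0 ℓ₁ ×ˢ Ioo 0 ℓ₂) : IntegrableOn f S :=
  (hf.continuousOn.integrableOn_compact (isCompact_Icc.prod isCompact_Icc)).mono_set
    (hS.trans (prod_mono Ioo_subset_Icc_self Ioo_subset_Icc_self))

lemma integral_sq_sum_phiR {ℓ₁ ℓ₂ : ℝ} {S : Set (ℝ × ℝ)} (hS : S ⊆ Ioo 0 ℓ₁ ×ˢ Ioo 0 ℓ₂)
    (K : Finset (ℕ × ℕ)) (a : ℕ × ℕ → ℝ) :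
    ∫ p in S, (∑ k ∈ K, a k * phiR ℓ₁ ℓ₂ k p) ^ 2 =
      ∑ k ∈ K, ∑ k' ∈ K, a k * a k' * ∫ p in S, phiR ℓ₁ ℓ₂ k p * phiR ℓ₁ ℓ₂ k' p :=
  integral_sq_sum K a _ fun _ _ _ _ =>
    Continuous.integrableOn_of_subset_rectangle (by fun_prop) hS

lemma integral_phiR_mul_phiR {ℓ₁ ℓ₂ : ℝ} (h₁ : 0 < ℓ₁) (J₁ J₂ : Set ℝ) (k k' : ℕ × ℕ) :
    ∫ p in J₁ ×ˢ J₂, phiR ℓ₁ ℓ₂ k p * phiR ℓ₁ ℓ₂ k' p =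
      sineGram ℓ₁ J₁ k.1 k'.1 * sineGram ℓ₂ J₂ k.2 k'.2 := by
  rw [sineGram, sineGram, ← setIntegral_prod_mul, ← Measure.volume_eq_prod]
  congr 1; ext p
  rw [phiR_eq h₁, phiR_eq h₁]
  ring

/-- Parseval's identity in the second variable on `J × (0,ℓ₂)`. -/
lemma integral_strip_fst {ℓ₁ ℓ₂ : ℝ} (h₁ : 0 < ℓ₁) (h₂ : 0 < ℓ₂) {J : Set ℝ}
    (hJ : J ⊆ Ioo 0 ℓ₁) {I : Finset ℕ} (hI : ∀ i ∈ I, 1 ≤ i) (a : ℕ × ℕ → ℝ) :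
    ∫ p in J ×ˢ Ioo 0 ℓ₂, (∑ k ∈ I ×ˢ I, a k * phiR ℓ₁ ℓ₂ k p) ^ 2 =
      ∑ q ∈ I, ∑ i ∈ I, ∑ j ∈ I, a (i, q) * a (j, q) * sineGram ℓ₁ J i j := by
  rw [integral_sq_sum_phiR (prod_mono hJ subset_rfl), Finset.sum_product_right]
  refine Finset.sum_congr rfl fun q hq => Finset.sum_congr rfl fun i _ => ?_
  rw [Finset.sum_product_right, Finset.sum_eq_single_of_mem q hq]
  · refine Finset.sum_congr rfl fun j _ => ?_
    rw [integral_phiR_mul_phiR h₁, sineGram_Ioo h₂ (hI q hq) (hI q hq), if_pos rfl, mul_one]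
  · intro q' hq' hne
    refine Finset.sum_eq_zero fun j _ => ?_
    rw [integral_phiR_mul_phiR h₁, sineGram_Ioo h₂ (hI q hq) (hI q' hq'), if_neg hne.symm,
      mul_zero, mul_zero]

/-- Parseval's identity in the first variable on `(0,ℓ₁) × J`. -/
lemma integral_strip_snd {ℓ₁ ℓ₂ : ℝ} (h₁ : 0 < ℓ₁) {J : Set ℝ}
    (hJ : J ⊆ Ioo 0 ℓ₂) {I : Finset ℕ} (hI : ∀ i ∈ I, 1 ≤ i) (a : ℕ × ℕ → ℝ) :
    ∫ p in Ioo 0 ℓ₁ ×ˢ J, (∑ k ∈ I ×ˢ I, a k * phiR ℓ₁ ℓ₂ k p) ^ 2 =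
      ∑ q ∈ I, ∑ i ∈ I, ∑ j ∈ I, a (q, i) * a (q, j) * sineGram ℓ₂ J i j := by
  rw [integral_sq_sum_phiR (prod_mono subset_rfl hJ), Finset.sum_product]
  refine Finset.sum_congr rfl fun q hq => Finset.sum_congr rfl fun i _ => ?_
  rw [Finset.sum_product, Finset.sum_eq_single_of_mem q hq]
  · refine Finset.sum_congr rfl fun j _ => ?_
    rw [integral_phiR_mul_phiR h₁, sineGram_Ioo h₁ (hI q hq) (hI q hq), if_pos rfl, one_mul]
  · intro q' hq' hne
    refine Finset.sum_eq_zero fun j _ => ?_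
    rw [integral_phiR_mul_phiR h₁, sineGram_Ioo h₁ (hI q hq) (hI q' hq'), if_neg hne.symm,
      zero_mul, mul_zero]

lemma exists_usol_eq {ℓ₁ ℓ₂ : ℝ} (F : Finset (ℕ × ℕ)) (hF : ∀ k ∈ F, 1 ≤ k.1 ∧ 1 ≤ k.2)
    (c d : ℕ × ℕ → ℝ) : ∃ (I : Finset ℕ) (r φ : ℕ × ℕ → ℝ), (∀ i ∈ I, 1 ≤ i) ∧
      ∑ k ∈ I ×ˢ I, r k ^ 2 = ∑ k ∈ F, c k ^ 2 + ∑ k ∈ F, d k ^ 2 / gam ℓ₁ ℓ₂ k ∧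
      ∀ t p, usol ℓ₁ ℓ₂ F c d t p =
        ∑ k ∈ I ×ˢ I, r k * cos (om ℓ₁ ℓ₂ k * t - φ k) * phiR ℓ₁ ℓ₂ k p := by
  have h := fun k => exists_amplitude_phase (c k) (d k / om ℓ₁ ℓ₂ k)
  choose r φ hr hφ using h
  have hsub : F ⊆ (F.image Prod.fst ∪ F.image Prod.snd) ×ˢ
      (F.image Prod.fst ∪ F.image Prod.snd) := by
    intro k hk
    simp only [Finset.mem_product, Finset.mem_union]
    exact ⟨Or.inl (Finset.mem_image_of_mem _ hk), Or.inr (Finset.mem_image_of_mem _ hk)⟩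
  refine ⟨F.image Prod.fst ∪ F.image Prod.snd, fun k => if k ∈ F then r k else 0, φ, ?_, ?_, ?_⟩
  · intro i hi
    simp only [Finset.mem_union, Finset.mem_image] at hi
    rcases hi with ⟨k, hk, rfl⟩ | ⟨k, hk, rfl⟩
    · exact (hF k hk).1
    · exact (hF k hk).2
  · rw [← Finset.sum_subset hsub (fun k _ hk => by simp [hk]), ← Finset.sum_add_distrib]
    refine Finset.sum_congr rfl fun k hk => ?_
    simp only [if_pos hk]
    rw [hr, div_pow, om, sq_sqrt (by unfold gam; positivity)]
  · intro t p
    rw [← Finset.sum_subset hsub (fun k _ hk => by simp [hk]), usol]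
    refine Finset.sum_congr rfl fun k hk => ?_
    simp only [if_pos hk]
    rw [hφ]

lemma ciInf_integral_sin_sq_le {ℓ : ℝ} (hℓ : 0 < ℓ) (J : Set ℝ) {k : ℕ} (hk : 1 ≤ k) :
    (⨅ k : ℕ+, ∫ x in J, sin (π * (k : ℝ) * x / ℓ) ^ 2) / ℓ ≤ sineGram ℓ J k k / 2 := by
  have h : (⨅ k : ℕ+, ∫ x in J, sin (π * (k : ℝ) * x / ℓ) ^ 2) ≤
      ∫ x in J, sin (π * ((⟨k, hk⟩ : ℕ+) : ℝ) * x / ℓ) ^ 2 :=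
    ciInf_le ⟨0, by rintro _ ⟨k, rfl⟩; exact integral_nonneg fun x => sq_nonneg _⟩ _
  rw [div_le_iff₀ hℓ]
  exact h.trans_eq ((integral_sin_sq_eq hℓ J k).trans (by ring))

open Classical in
/-- Observability on the two strips, with the constant in terms of `m` and the time ratio. -/
lemma observability_of_le {ℓ₁ ℓ₂ : ℝ} (h₁ : 0 < ℓ₁) (h₂ : 0 < ℓ₂) {J₁ J₂ : Set ℝ}
    (hJ₁ : J₁ ⊆ Ioo 0 ℓ₁) (hJ₂ : J₂ ⊆ Ioo 0 ℓ₂) {m : ℝ}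
    (hm₀ : 0 ≤ m) (hm₁ : ∀ k, 1 ≤ k → m ≤ sineGram ℓ₁ J₁ k k / 2)
    (hm₂ : ∀ k, 1 ≤ k → m ≤ sineGram ℓ₂ J₂ k k / 2)
    {T : ℝ} (hT : 2 * √(ℓ₁ ^ 2 + ℓ₂ ^ 2) ≤ T) {I : Finset ℕ} (hI : ∀ i ∈ I, 1 ≤ i)
    (r φ : ℕ × ℕ → ℝ) :
    T / π * (m - (2 * √(ℓ₁ ^ 2 + ℓ₂ ^ 2) / T) ^ 2 / 2) * ∑ k ∈ I ×ˢ I, r k ^ 2 ≤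
      ∫ t in (0 : ℝ)..T, ∫ p in (J₁ ×ˢ Ioo 0 ℓ₂) ∪ (Ioo 0 ℓ₁ ×ˢ J₂),
        (∑ k ∈ I ×ˢ I, r k * cos (om ℓ₁ ℓ₂ k * t - φ k) * phiR ℓ₁ ℓ₂ k p) ^ 2 := by
  set L := √(ℓ₁ ^ 2 + ℓ₂ ^ 2) with hLdef
  have hL : 0 < L := by positivity
  have hT0 : 0 < T := by linarith
  have hπ := pi_pos
  set S := (J₁ ×ˢ Ioo 0 ℓ₂) ∪ (Ioo 0 ℓ₁ ×ˢ J₂) with hS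
  have hSsub : S ⊆ Ioo 0 ℓ₁ ×ˢ Ioo 0 ℓ₂ :=
    union_subset (prod_mono hJ₁ subset_rfl) (prod_mono subset_rfl hJ₂)
  set a : ℝ → ℕ × ℕ → ℝ := fun t k => r k * cos (om ℓ₁ ℓ₂ k * t - φ k) with ha
  have hac : ∀ k, Continuous fun t => a t k := fun k => by simp only [ha]; fun_prop
  set V₁ : ℝ → ℝ := fun t =>
    ∑ q ∈ I, ∑ i ∈ I, ∑ j ∈ I, a t (i, q) * a t (j, q) * sineGram ℓ₁ J₁ i j with hV₁
  set V₂ : ℝ → ℝ := fun t =>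
    ∑ q ∈ I, ∑ i ∈ I, ∑ j ∈ I, a t (q, i) * a t (q, j) * sineGram ℓ₂ J₂ i j with hV₂
  have hV₁c : Continuous V₁ := by simp only [hV₁]; fun_prop
  have hV₂c : Continuous V₂ := by simp only [hV₂]; fun_prop
  have hVc : Continuous fun t => ∫ p in S, (∑ k ∈ I ×ˢ I, a t k * phiR ℓ₁ ℓ₂ k p) ^ 2 := by
    simp only [integral_sq_sum_phiR hSsub]
    fun_prop
  have hSint : ∀ t, IntegrableOn (fun p => (∑ k ∈ I ×ˢ I, a t k * phiR ℓ₁ ℓ₂ k p) ^ 2) S :=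
    fun t => Continuous.integrableOn_of_subset_rectangle (by fun_prop) hSsub
  have hsq : ∀ t (U : Set (ℝ × ℝ)), 0 ≤ᵐ[volume.restrict U]
      fun p => (∑ k ∈ I ×ˢ I, a t k * phiR ℓ₁ ℓ₂ k p) ^ 2 := fun t U =>
    Filter.Eventually.of_forall fun p => sq_nonneg _
  have hle₁ : ∀ t, V₁ t ≤ ∫ p in S, (∑ k ∈ I ×ˢ I, a t k * phiR ℓ₁ ℓ₂ k p) ^ 2 := fun t => by
    refine (integral_strip_fst h₁ h₂ hJ₁ hI (a t)).symm.trans_le ?_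
    exact setIntegral_mono_set (hSint t) (hsq t _) subset_union_left.eventuallyLE
  have hle₂ : ∀ t, V₂ t ≤ ∫ p in S, (∑ k ∈ I ×ˢ I, a t k * phiR ℓ₁ ℓ₂ k p) ^ 2 := fun t => by
    refine (integral_strip_snd h₁ hJ₂ hI (a t)).symm.trans_le ?_
    exact setIntegral_mono_set (hSint t) (hsq t _) subset_union_right.eventuallyLE
  have hmono : 1 / 2 * ((∫ t in (0 : ℝ)..T, sin (π * t / T) * V₁ t) +
      ∫ t in (0 : ℝ)..T, sin (π * t / T) * V₂ t) ≤
      ∫ t in (0 : ℝ)..T, ∫ p in S, (∑ k ∈ I ×ˢ I, a t k * phiR ℓ₁ ℓ₂ k p) ^ 2 := by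
    rw [← intervalIntegral.integral_add (Continuous.intervalIntegrable (by fun_prop) _ _)
      (Continuous.intervalIntegrable (by fun_prop) _ _), ← intervalIntegral.integral_const_mul]
    refine intervalIntegral.integral_mono_on hT0.le
      (Continuous.intervalIntegrable (by fun_prop) _ _) (hVc.intervalIntegrable _ _)
      fun t ht => ?_
    have hw := sin_weight_nonneg hT0 ht
    have hw1 := sin_le_one (π * t / T)
    have hV0 : 0 ≤ ∫ p in S, (∑ k ∈ I ×ˢ I, a t k * phiR ℓ₁ ℓ₂ k p) ^ 2 :=
      integral_nonneg fun p => sq_nonneg _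
    have e1 := mul_le_mul_of_nonneg_left (hle₁ t) hw
    have e2 := mul_le_mul_of_nonneg_left (hle₂ t) hw
    have e3 := mul_le_mul_of_nonneg_right hw1 hV0
    linarith
  refine le_trans ?_ hmono
  set y := (2 * L / T) ^ 2 with hy
  have hy0 : 0 ≤ y := sq_nonneg _
  have hQ₁ : ∑ q ∈ I, T / π * ∑ i ∈ I, r (i, q) ^ 2 *
      (if diagFreq ℓ₁ ℓ₂ (i, q) ≤ (ℓ₁ ^ 2 + ℓ₂ ^ 2) / ℓ₁ ^ 2 * i then
        sineGram ℓ₁ J₁ i i - 1 / 2 * y else - (44 / 100 * y)) ≤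
      ∫ t in (0 : ℝ)..T, sin (π * t / T) * V₁ t := by
    simp_rw [hV₁, Finset.mul_sum I _ (sin _)]
    rw [intervalIntegral.integral_finsetSum fun q _ =>
      Continuous.intervalIntegrable (by fun_prop) _ _]
    refine Finset.sum_le_sum fun q hq => ?_
    refine ((kleinGordon_diagFreq h₁ h₂ (hI q hq)).le_integral hL hT h₁ hJ₁
      (fun i => r (i, q)) (fun i => φ (i, q)) hI).trans_eq ?_
    simp only [ha, om_eq h₁, Finset.mul_sum, hLdef]
  have hQ₂ : ∑ q ∈ I, T / π * ∑ i ∈ I, r (q, i) ^ 2 *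
      (if diagFreq ℓ₁ ℓ₂ (q, i) ≤ (ℓ₁ ^ 2 + ℓ₂ ^ 2) / ℓ₂ ^ 2 * i then
        sineGram ℓ₂ J₂ i i - 1 / 2 * y else - (44 / 100 * y)) ≤
      ∫ t in (0 : ℝ)..T, sin (π * t / T) * V₂ t := by
    simp_rw [hV₂, Finset.mul_sum I _ (sin _)]
    rw [intervalIntegral.integral_finsetSum fun q _ =>
      Continuous.intervalIntegrable (by fun_prop) _ _]
    refine Finset.sum_le_sum fun q hq => ?_
    have := (kleinGordon_diagFreq h₂ h₁ (hI q hq)).le_integral hL hT h₂ hJ₂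
      (fun i => r (q, i)) (fun i => φ (q, i)) hI
    simp only [← diagFreq_swap ℓ₁ ℓ₂, add_comm (ℓ₂ ^ 2)] at this
    refine this.trans_eq ?_
    simp only [ha, om_eq h₁, Finset.mul_sum, hLdef]
  refine le_trans ?_ (mul_le_mul_of_nonneg_left (add_le_add hQ₁ hQ₂) (by norm_num))
  rw [← Finset.mul_sum, ← Finset.mul_sum, Finset.sum_comm, ← mul_add, ← Finset.sum_add_distrib,
    mul_left_comm, mul_assoc]
  refine mul_le_mul_of_nonneg_left ?_ (by positivity)
  rw [Finset.sum_product, Finset.mul_sum, Finset.mul_sum]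
  refine Finset.sum_le_sum fun i hi => ?_
  rw [← Finset.sum_add_distrib, Finset.mul_sum, Finset.mul_sum]
  refine Finset.sum_le_sum fun j hj => ?_
  rw [← mul_add, mul_left_comm, mul_comm]
  refine mul_le_mul_of_nonneg_left ?_ (sq_nonneg _)
  have k₁ := hm₁ i (hI i hi)
  have k₂ := hm₂ j (hI j hj)
  split_ifs with g₁ g₂ g₂
  · linarith
  · linarith
  · linarith
  · exfalso
    rcases le_total (ℓ₁ ^ 2 * (j : ℝ)) (ℓ₂ ^ 2 * i) with hle | hle
    · exact g₁ (diagFreq_le_of_le h₁ h₂ hle)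
    · refine g₂ ?_
      rw [diagFreq_swap, add_comm (ℓ₁ ^ 2)]
      exact diagFreq_le_of_le h₂ h₁ hle

/-- Internal observability of the wave equation on the rectangle `(0,ℓ₁) × (0,ℓ₂)`
over the set `S̄ = (J₁×(0,ℓ₂)) ∪ ((0,ℓ₁)×J₂)`, for any time `T` with
`(ℓ₁²+ℓ₂²)(ℓ₁⁴+ℓ₂⁴)/(T²ℓ₁²ℓ₂²) < m = min{t₁/ℓ₁, t₂/ℓ₂}`, with observability constant
`c = (T/π)(m − (ℓ₁²+ℓ₂²)(ℓ₁⁴+ℓ₂⁴)/(T²ℓ₁²ℓ₂²)) > 0`. -/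
theorem stmt16 (ℓ₁ ℓ₂ : ℝ) (hℓ₁ : 0 < ℓ₁) (hℓ₂ : 0 < ℓ₂)
    (J₁ J₂ : Set ℝ) (hJ₁m : MeasurableSet J₁) (hJ₂m : MeasurableSet J₂)
    (hJ₁ : J₁ ⊆ Set.Ioo 0 ℓ₁) (hJ₂ : J₂ ⊆ Set.Ioo 0 ℓ₂)
    (t₁ t₂ m : ℝ)
    (ht₁ : t₁ = ⨅ k : ℕ+, ∫ x in J₁, Real.sin (π * (k : ℝ) * x / ℓ₁) ^ 2)
    (ht₂ : t₂ = ⨅ k : ℕ+, ∫ x in J₂, Real.sin (π * (k : ℝ) * x / ℓ₂) ^ 2)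
    (hm : m = min (t₁ / ℓ₁) (t₂ / ℓ₂))
    (T : ℝ) (hT0 : 0 < T)
    (hT : (ℓ₁ ^ 2 + ℓ₂ ^ 2) * (ℓ₁ ^ 4 + ℓ₂ ^ 4) / (T ^ 2 * ℓ₁ ^ 2 * ℓ₂ ^ 2) < m)
    (F : Finset (ℕ × ℕ)) (hF : ∀ k ∈ F, 1 ≤ k.1 ∧ 1 ≤ k.2)
    (c d : ℕ × ℕ → ℝ) :
    0 < T / π * (m - (ℓ₁ ^ 2 + ℓ₂ ^ 2) * (ℓ₁ ^ 4 + ℓ₂ ^ 4) / (T ^ 2 * ℓ₁ ^ 2 * ℓ₂ ^ 2)) ∧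
    T / π * (m - (ℓ₁ ^ 2 + ℓ₂ ^ 2) * (ℓ₁ ^ 4 + ℓ₂ ^ 4) / (T ^ 2 * ℓ₁ ^ 2 * ℓ₂ ^ 2)) *
        (∑ k ∈ F, c k ^ 2 + ∑ k ∈ F, d k ^ 2 / gam ℓ₁ ℓ₂ k) ≤
      ∫ t in Set.Ioo (0 : ℝ) T,
        ∫ p in (J₁ ×ˢ Set.Ioo 0 ℓ₂) ∪ (Set.Ioo 0 ℓ₁ ×ˢ J₂), (usol ℓ₁ ℓ₂ F c d t p) ^ 2 := by
  set D := (ℓ₁ ^ 2 + ℓ₂ ^ 2) * (ℓ₁ ^ 4 + ℓ₂ ^ 4) / (T ^ 2 * ℓ₁ ^ 2 * ℓ₂ ^ 2) with hD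
  set L := √(ℓ₁ ^ 2 + ℓ₂ ^ 2) with hL
  have hL2 : L ^ 2 = ℓ₁ ^ 2 + ℓ₂ ^ 2 := sq_sqrt (by positivity)
  have hLD : (2 * L / T) ^ 2 / 2 ≤ D := by
    rw [div_pow, mul_pow, hL2, hD, div_div, div_le_div_iff₀ (by positivity) (by positivity)]
    have : 0 ≤ T ^ 2 * (ℓ₁ ^ 2 + ℓ₂ ^ 2) * (ℓ₁ ^ 2 - ℓ₂ ^ 2) ^ 2 := by positivity
    nlinarith
  have hm₁ : ∀ k, 1 ≤ k → m ≤ sineGram ℓ₁ J₁ k k / 2 := fun k hk => by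
    rw [hm, ht₁]
    exact (min_le_left _ _).trans (ciInf_integral_sin_sq_le hℓ₁ J₁ hk)
  have hm₂ : ∀ k, 1 ≤ k → m ≤ sineGram ℓ₂ J₂ k k / 2 := fun k hk => by
    rw [hm, ht₂]
    exact (min_le_right _ _).trans (ciInf_integral_sin_sq_le hℓ₂ J₂ hk)
  have hD0 : 0 ≤ D := by positivity
  have hm0 : 0 < m := hD0.trans_lt hT
  have hmhalf : m ≤ 1 / 2 := by
    linarith [hm₁ 1 le_rfl, sineGram_self_le_one hℓ₁ hJ₁ (le_refl 1)]
  have hTL : 2 * L ≤ T := by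
    have h1 : (2 * L / T) ^ 2 ≤ 1 := by linarith
    have h2 : 2 * L / T ≤ 1 := le_of_sq_le_sq (by simpa using h1) zero_le_one
    rwa [div_le_one hT0] at h2
  refine ⟨mul_pos (by positivity) (by linarith), ?_⟩
  obtain ⟨I, r, φ, hI, hr, hu⟩ := exists_usol_eq (ℓ₁ := ℓ₁) (ℓ₂ := ℓ₂) F hF c d
  simp only [hu]
  rw [← hr, ← integral_Ioc_eq_integral_Ioo, ← intervalIntegral.integral_of_le hT0.le]
  refine le_trans ?_ (observability_of_le hℓ₁ hℓ₂ hJ₁ hJ₂ hm0.le hm₁ hm₂ hTL hI r φ)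
  refine mul_le_mul_of_nonneg_right ?_ (Finset.sum_nonneg fun k _ => sq_nonneg _)
  exact mul_le_mul_of_nonneg_left (by linarith) (by positivity)

end
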